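/- arXiv:1002.4470 — 4 statements merged into one kernel-verified Lean document; each statement's English description precedes it below -/
import Mathlib

section
/- Let N₀ > 0, β > 0, P > 0 and let M be a positive integer. For each integer τ ≥ 1, let s(τ) denote the unique positive solution of s = N₀ + β P · s / (τ P / M + s), and set ξ²(τ) = s(τ) / (τ P / M + s(τ)). Then s(τ) > N₀ for every τ ≥ 1, and both τ ↦ s(τ) and τ ↦ ξ²(τ) are strictly decreasing: for all integers 1 ≤ τ₁ < τ₂, s(τ₂) < s(τ₁) and ξ²(τ₂) < ξ²(τ₁). -/
theorem lt_of_eq_add_mul_div {N c a x : ℝ} (hc : 0 < c) (ha : 0 ≤ a) (hx : 0 < x)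
    (h : x = N + c * x / (a + x)) : N < x := by
  have : 0 < c * x / (a + x) := by positivity
  linarith

theorem sub_mul_add_of_eq_add_mul_div {N c a x : ℝ} (ha : 0 ≤ a) (hx : 0 < x)
    (h : x = N + c * x / (a + x)) : (x - N) * (a + x) = c * x :=
  (eq_div_iff (by positivity)).mp (by linarith)

/-- The positive solution of `x = N + c x / (a + x)` is strictly decreasing in `a`. -/
theorem lt_of_eq_add_mul_div_of_lt {N c a b x y : ℝ} (hN : 0 ≤ N) (hc : 0 < c) (ha : 0 ≤ a)
    (hab : a < b) (hx : 0 < x) (hy : 0 < y)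
    (h₁ : x = N + c * x / (a + x)) (h₂ : y = N + c * y / (b + y)) : y < x := by
  have hxN := lt_of_eq_add_mul_div hc ha hx h₁
  have e₁ := sub_mul_add_of_eq_add_mul_div ha hx h₁
  have e₂ := sub_mul_add_of_eq_add_mul_div (ha.trans hab.le) hy h₂
  by_contra! hxy
  have hle : y * (x - N) ≤ x * (y - N) := by
    linarith [mul_le_mul_of_nonneg_left hxy hN]
  have hlt : y * (x - N) * (a + x) < x * (y - N) * (b + y) :=
    mul_lt_mul' hle (by linarith) (by positivity)
      ((mul_pos hy (sub_pos.mpr hxN)).trans_le hle)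
  have heq : y * (x - N) * (a + x) = x * (y - N) * (b + y) := by
    linear_combination y * e₁ - x * e₂
  exact hlt.ne heq

/-- Monotonicity of the training-phase fixed point: if `s τ` is the unique positive
solution of `s = N₀ + β P s / (τ P / M + s)`, then `s τ > N₀` for all `τ ≥ 1`, and both
`τ ↦ s τ` and the channel-estimation error variance `τ ↦ ξ²(τ) = s τ / (τ P / M + s τ)`
are strictly decreasing in `τ`. -/
theorem training_fixed_point_monotone (N₀ β P : ℝ) (hN₀ : 0 < N₀) (hβ : 0 < β)
    (hP : 0 < P) (M : ℕ) (hM : 0 < M) (s : ℕ → ℝ)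
    (hs : ∀ τ : ℕ, 1 ≤ τ →
      0 < s τ ∧ s τ = N₀ + β * P * s τ / ((τ : ℝ) * P / (M : ℝ) + s τ))
    (hsuniq : ∀ τ : ℕ, 1 ≤ τ → ∀ s' : ℝ, 0 < s' →
      s' = N₀ + β * P * s' / ((τ : ℝ) * P / (M : ℝ) + s') → s' = s τ) :
    (∀ τ : ℕ, 1 ≤ τ → N₀ < s τ) ∧
    (∀ τ₁ τ₂ : ℕ, 1 ≤ τ₁ → τ₁ < τ₂ →
      s τ₂ < s τ₁ ∧
      s τ₂ / ((τ₂ : ℝ) * P / (M : ℝ) + s τ₂)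
        < s τ₁ / ((τ₁ : ℝ) * P / (M : ℝ) + s τ₁)) := by
  have hc : 0 < β * P := mul_pos hβ hP
  have hM' : (0 : ℝ) < M := Nat.cast_pos.mpr hM
  refine ⟨fun τ hτ => lt_of_eq_add_mul_div hc (by positivity) (hs τ hτ).1 (hs τ hτ).2,
    fun τ₁ τ₂ h₁ h₁₂ => ?_⟩
  obtain ⟨hx, e₁⟩ := hs τ₁ h₁
  obtain ⟨hy, e₂⟩ := hs τ₂ (h₁.trans h₁₂.le)
  have hab : (τ₁ : ℝ) * P / M < (τ₂ : ℝ) * P / M := by gcongr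
  have hlt : s τ₂ < s τ₁ :=
    lt_of_eq_add_mul_div_of_lt hN₀.le hc (by positivity) hab hx hy e₁ e₂
  refine ⟨hlt, lt_of_mul_lt_mul_left ?_ hc.le⟩
  rw [← mul_div_assoc, ← mul_div_assoc]
  linarith
end

section
/- Fix integers n ≥ 1 and d ≥ 1 and reals β > 0 and N₀ > 0. Let A = (β/(N₀(1+n))) · B ⊗ I_d be the replica coupling matrix, where B = [[n, −1ₙᵀ], [−1ₙ, (1+n) Iₙ − Jₙ]] and ⊗ is the Kronecker product, Jₙ the n×n all-ones matrix and 1ₙ the all-ones vector. Let Q₀, Q₁, Q ∈ ℂ^{d×d} be Hermitian, M ∈ ℂ^{d×d} arbitrary, and let 𝒬 be the replica-symmetric matrix 𝒬 = [[Q₀, 1ₙᵀ ⊗ M], [1ₙ ⊗ M^H, Iₙ ⊗ (Q₁ − Q) + Jₙ ⊗ Q]] of size (n+1)d. Define Σ₀ = N₀ I_d + β(Q₀ − M − M^H + Q) and Σ = N₀ I_d + β(Q₁ − Q). Then det( I_{(n+1)d} + A 𝒬 ) = (det Σ)^{n−1} · det(Σ + n Σ₀) / ( N₀^{n d} · (1+n)^{d}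 ). -/
open Matrix Finset Kronecker

/-- The replica-symmetric matrix `[[X₀, 1ₙᵀ ⊗ Y], [1ₙ ⊗ Yᴴ, Iₙ ⊗ (X₁ − X) + Jₙ ⊗ X]]`
of size `(n+1)d`, written entrywise over the index `Fin (n+1) × Fin d`. -/
noncomputable def rsMat (n d : ℕ) (X₀ Y X₁ X : Matrix (Fin d) (Fin d) ℂ) :
    Matrix (Fin (n + 1) × Fin d) (Fin (n + 1) × Fin d) ℂ :=
  Matrix.of fun p q =>
    if p.1 = 0 then (if q.1 = 0 then X₀ p.2 q.2 else Y p.2 q.2)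
    else if q.1 = 0 then Yᴴ p.2 q.2
    else if p.1 = q.1 then X₁ p.2 q.2 else X p.2 q.2

/-- Left multiplication by `K ⊗ I` acts on the first index only. -/
theorem kronecker_one_mul_apply {l m k p R : Type*} [Fintype m] [Fintype k] [DecidableEq k]
    [CommRing R] (K : Matrix l m R) (N : Matrix (m × k) p R) (a : l) (i : k) (q : p) :
    ((K ⊗ₖ (1 : Matrix k k R)) * N) (a, i) q = ∑ x, K a x * N (x, i) q := by
  simp [Matrix.mul_apply, Fintype.sum_prod_type, Matrix.one_apply]

/-- Right multiplication by `K ⊗ I` acts on the first index only. -/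
theorem mul_kronecker_one_apply {l m k p R : Type*} [Fintype m] [Fintype k] [DecidableEq k]
    [CommRing R] (K : Matrix m l R) (N : Matrix p (m × k) R) (b : l) (j : k) (q : p) :
    (N * (K ⊗ₖ (1 : Matrix k k R))) q (b, j) = ∑ x, N q (x, j) * K x b := by
  simp [Matrix.mul_apply, Fintype.sum_prod_type, Matrix.one_apply]

/-- The determinant of `I ⊗ X + J ⊗ Y`, with `J` the all-ones matrix of size `m + 1`. -/
theorem det_one_kronecker_add_ones_kronecker {k R : Type*} [Fintype k] [DecidableEq k]
    [CommRing R] (m : ℕ) (X Y : Matrix k k R) :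
    ((1 : Matrix (Fin (m + 1)) (Fin (m + 1)) R) ⊗ₖ X
        + (Matrix.of fun _ _ => 1 : Matrix (Fin (m + 1)) (Fin (m + 1)) R) ⊗ₖ Y).det
      = X.det ^ m * (X + ((m + 1 : ℕ) : R) • Y).det := by
  let J : Matrix (Fin (m + 1)) (Fin (m + 1)) R := Matrix.of fun _ _ => 1
  let P : Matrix (Fin (m + 1)) (Fin (m + 1)) R :=
    Matrix.of fun a b => if b = 0 then 1 else if a = b then 1 else 0
  let P' : Matrix (Fin (m + 1)) (Fin (m + 1)) R :=
    Matrix.of fun a b => if a = b then 1 else if b = 0 then -1 else 0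
  let T : Matrix (Fin (m + 1)) (Fin (m + 1)) R :=
    Matrix.of fun a b => if a = 0 then (if b = 0 then ((m + 1 : ℕ) : R) else 1) else 0
  have hPP : P' * P = 1 := by
    ext a b
    cases a using Fin.cases <;> cases b using Fin.cases <;>
      simp [P, P', Matrix.mul_apply, Fin.sum_univ_succ, Matrix.one_apply, Fin.succ_ne_zero,
        (Fin.succ_ne_zero _).symm]
  have hT : P' * J * P = T := by
    ext a b
    cases a using Fin.cases <;> cases b using Fin.cases <;>
      simp [P, P', J, T, Matrix.mul_apply, Fin.sum_univ_succ, Fin.succ_ne_zero,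
        (Fin.succ_ne_zero _).symm, add_comm]
  have hconj : (P' ⊗ₖ (1 : Matrix k k R)) * ((1 : Matrix _ _ R) ⊗ₖ X + J ⊗ₖ Y) * (P ⊗ₖ 1)
      = (1 : Matrix _ _ R) ⊗ₖ X + T ⊗ₖ Y := by
    simp only [mul_add, add_mul, ← Matrix.mul_kronecker_mul, hT, mul_one, one_mul, hPP]
  have hdet : (P' ⊗ₖ (1 : Matrix k k R)).det * (P ⊗ₖ (1 : Matrix k k R)).det = 1 := by
    rw [← Matrix.det_mul, ← Matrix.mul_kronecker_mul, hPP]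
    simp
  have htri : ((1 : Matrix _ _ R) ⊗ₖ X + T ⊗ₖ Y).BlockTriangular Prod.fst := by
    rintro ⟨a, i⟩ ⟨b, j⟩ hab
    have hab' : b < a := hab
    have ha : a ≠ 0 := (Fin.zero_le b |>.trans_lt hab').ne'
    simp [T, ha, hab'.ne']
  have hblock (a : Fin (m + 1)) :
      (((1 : Matrix _ _ R) ⊗ₖ X + T ⊗ₖ Y).toSquareBlock Prod.fst a).det
        = (X + T a a • Y).det := by
    let e : k ≃ {p : Fin (m + 1) × k // p.1 = a} :=
      ⟨fun i => ⟨(a, i), rfl⟩, fun p => p.1.2, fun _ => rfl, by rintro ⟨⟨_, _⟩, rfl⟩; rfl⟩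
    rw [← Matrix.det_submatrix_equiv_self e]
    congr 1
    ext i j
    simp [e, Matrix.toSquareBlock_def]
  calc _ = ((P' ⊗ₖ (1 : Matrix k k R)) * ((1 : Matrix _ _ R) ⊗ₖ X + J ⊗ₖ Y) * (P ⊗ₖ 1)).det := by
        rw [Matrix.det_mul, Matrix.det_mul, mul_right_comm, hdet, one_mul]
    _ = _ := by
        rw [hconj, htri.det_fintype]
        simp only [hblock, Fin.prod_univ_succ]
        simp [T, Fin.succ_ne_zero, mul_comm]

/-- Replica-symmetric evaluation of the determinant in the free energy:
`det(I + A 𝒬) = (det Σ)^(n−1) det(Σ + n Σ₀) / (N₀^{nd} (1+n)^d)`. -/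
theorem det_replica_symmetric_free_energy (n d : ℕ) (hn : 1 ≤ n) (hd : 1 ≤ d)
    (β N₀ : ℝ) (hβ : 0 < β) (hN₀ : 0 < N₀)
    (Q₀ Q₁ Q M : Matrix (Fin d) (Fin d) ℂ)
    (hQ₀ : Q₀.IsHermitian) (hQ₁ : Q₁.IsHermitian) (hQ : Q.IsHermitian) :
    let B : Matrix (Fin (n + 1)) (Fin (n + 1)) ℂ :=
      Matrix.of fun a b =>
        if a = 0 then (if b = 0 then (n : ℂ) else -1)
        else if b = 0 then -1
        else (if a = b then 1 + (n : ℂ) else 0) - 1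
    let A : Matrix (Fin (n + 1) × Fin d) (Fin (n + 1) × Fin d) ℂ :=
      ((β / (N₀ * (1 + (n : ℝ))) : ℝ) : ℂ) • (B ⊗ₖ (1 : Matrix (Fin d) (Fin d) ℂ))
    let Qm := rsMat n d Q₀ M Q₁ Q
    let S₀ : Matrix (Fin d) (Fin d) ℂ := (N₀ : ℂ) • 1 + (β : ℂ) • (Q₀ - M - Mᴴ + Q)
    let S : Matrix (Fin d) (Fin d) ℂ := (N₀ : ℂ) • 1 + (β : ℂ) • (Q₁ - Q)
    (1 + A * Qm).det
      = S.det ^ (n - 1) * (S + (n : ℂ) • S₀).det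
        / ((N₀ : ℂ) ^ (n * d) * (1 + (n : ℂ)) ^ d) := by
  intro B A Qm S₀ S
  let V : Matrix (Fin (n + 1)) (Fin n) ℂ :=
    Matrix.of fun a b => if a = 0 then -1 else if a = b.succ then 1 else 0
  let W : Matrix (Fin n) (Fin (n + 1)) ℂ := Matrix.of fun a b => B a.succ b
  let c : ℂ := ((β / (N₀ * (1 + (n : ℝ))) : ℝ) : ℂ)
  let D := Q₁ - Q
  let E := Q₀ - M - Mᴴ + Q
  have hN : (N₀ : ℂ) ≠ 0 := by exact_mod_cast hN₀.ne'
  have hn1 : (1 + n : ℂ) ≠ 0 := by exact_mod_cast (by omega : 1 + n ≠ 0)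
  have hc : (N₀ : ℂ) * (1 + n) * c = β := by
    simp only [c]; push_cast; field_simp
  have hB : B = V * W := by
    ext a b
    cases a using Fin.cases <;> cases b using Fin.cases <;>
      simp [B, V, W, Matrix.mul_apply, Fin.succ_ne_zero, Finset.sum_sub_distrib]
  have hWQV : (W ⊗ₖ (1 : Matrix (Fin d) (Fin d) ℂ)) * Qm
      * (V ⊗ₖ (1 : Matrix (Fin d) (Fin d) ℂ))
      = (1 : Matrix (Fin n) (Fin n) ℂ) ⊗ₖ ((1 + n : ℂ) • D)
        + (Matrix.of fun _ _ => 1 : Matrix (Fin n) (Fin n) ℂ) ⊗ₖ (E - D) := by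
    ext ⟨a, i⟩ ⟨b, j⟩
    have hsum (f : Fin (n + 1) → ℂ) :
        ∑ x, W a x * f x = (1 + n) * f a.succ - ∑ x, f x := by
      simp [W, B, Fin.sum_univ_succ, Fin.succ_ne_zero, sub_mul, Finset.sum_sub_distrib]
      ring
    have hite (x : Fin n) : (if x = b then Q₁ i j else Q i j)
        = Q i j + if x = b then Q₁ i j - Q i j else 0 := by
      split_ifs <;> ring
    rw [mul_kronecker_one_apply]
    simp only [kronecker_one_mul_apply, hsum]
    simp [V, Qm, rsMat, Fin.sum_univ_succ, Fin.succ_ne_zero,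
      Matrix.one_apply, D, E, hite, Finset.sum_add_distrib]
    split_ifs <;> ring
  have hX : 1 + c • ((1 + n : ℂ) • D) = (N₀ : ℂ)⁻¹ • S := by
    have h : c * (1 + n) = (N₀ : ℂ)⁻¹ * β := by rw [← hc]; field_simp
    simp only [S, smul_add, smul_smul, inv_mul_cancel₀ hN, one_smul, h, D]
  have hXY : (N₀ : ℂ)⁻¹ • S + (n : ℂ) • c • (E - D)
      = ((N₀ : ℂ) * (1 + n))⁻¹ • (S + (n : ℂ) • S₀) := by
    ext i j
    simp only [S, S₀, ← hc, Matrix.add_apply, Matrix.sub_apply, Matrix.smul_apply,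
      smul_eq_mul, D, E]
    field_simp
    ring
  have hdet : (1 + A * Qm).det = ((1 : Matrix (Fin n) (Fin n) ℂ) ⊗ₖ ((N₀ : ℂ)⁻¹ • S)
      + (Matrix.of fun _ _ => 1 : Matrix (Fin n) (Fin n) ℂ) ⊗ₖ (c • (E - D))).det := by
    have hA : A * Qm = (V ⊗ₖ (1 : Matrix (Fin d) (Fin d) ℂ)) *
        (c • ((W ⊗ₖ (1 : Matrix (Fin d) (Fin d) ℂ)) * Qm)) := by
      simp only [A, hB, Matrix.smul_mul, Matrix.mul_smul, ← Matrix.mul_assoc,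
        ← Matrix.mul_kronecker_mul, mul_one, c]
    rw [hA, Matrix.det_one_add_mul_comm, Matrix.smul_mul, hWQV, ← hX, smul_add,
      Matrix.kronecker_add, Matrix.one_kronecker_one, Matrix.kronecker_smul _ _ (E - D),
      Matrix.kronecker_smul c, add_assoc]
  obtain ⟨m, rfl⟩ := Nat.exists_eq_add_of_le' hn
  rw [hdet, det_one_kronecker_add_ones_kronecker, hXY, Matrix.det_smul, Matrix.det_smul,
    Fintype.card_fin, Nat.add_sub_cancel, inv_pow, inv_pow, mul_pow, mul_pow, inv_pow]
  field_simp
  ring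
end

section
/- Fix integers n ≥ 1 and d ≥ 1 and reals β > 0 and N₀ > 0. Let A = (β/(N₀(1+n))) · B ⊗ I_d with B = [[n, −1ₙᵀ], [−1ₙ, (1+n) Iₙ − Jₙ]], let Q₀, Q₁, Q ∈ ℂ^{d×d} be Hermitian and M ∈ ℂ^{d×d}, let 𝒬 = [[Q₀, 1ₙᵀ ⊗ M], [1ₙ ⊗ M^H, Iₙ ⊗ (Q₁ − Q) + Jₙ ⊗ Q]], and set Σ₀ = N₀ I_d + β(Q₀ − M − M^H + Q) and Σ = N₀ I_d + β(Q₁ − Q). Assume Σ and Σ + n Σ₀ are invertible. Then I_{(n+1)d} + A 𝒬 is invertible, and −β^{-1} (I + A 𝒬)^{-1} A equals the replica-symmetric matrix 𝒬̃ = [[Q̃₀, 1ₙᵀ ⊗ M̃], [1ₙ ⊗ M̃^H, Iₙ ⊗ (Q̃₁ − Q̃) + Jₙ ⊗ Q̃]] with blocks Q̃₀ = −n (Σ + n Σ₀)^{-1}, M̃ = (Σ + n Σ₀)^{-1}, Q̃ = (Σ + n Σ₀)^{-1} Σ₀ Σ^{-1}, and Q̃₁ = Q̃ − Σ^{-1}.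 -/
open Matrix Finset Kronecker

/-- The block matrix `[[X₀, 1ₙᵀ ⊗ Y], [1ₙ ⊗ Z, Iₙ ⊗ (X₁ - X) + Jₙ ⊗ X]]` over a ring. -/
def rsBlock {E : Type*} (n : ℕ) (X₀ Y Z X₁ X : E) : Matrix (Fin (n + 1)) (Fin (n + 1)) E :=
  Matrix.of fun a b =>
    if a = 0 then (if b = 0 then X₀ else Y)
    else if b = 0 then Z else if a = b then X₁ else X

/-- The matrix `(n + 1) I - J` of size `n + 1`. -/
def centering (n : ℕ) (E : Type*) [Ring E] : Matrix (Fin (n + 1)) (Fin (n + 1)) E :=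
  Matrix.of fun a b => (if a = b then (n : E) + 1 else 0) - 1

theorem centering_mul_apply {E : Type*} [Ring E] {n : ℕ}
    (R : Matrix (Fin (n + 1)) (Fin (n + 1)) E) (a c : Fin (n + 1)) :
    (centering n E * R) a c = (n + 1) * R a c - ∑ b, R b c := by
  simp [centering, Matrix.mul_apply, sub_mul, ite_mul, Finset.sum_sub_distrib]

theorem rsBlock_mul_rsBlock {E : Type*} [Ring E] {n : ℕ} (X₀ Y Z X₁ X X₀' Y' Z' X₁' X' : E) :
    rsBlock n X₀ Y Z X₁ X * rsBlock n X₀' Y' Z' X₁' X' =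
      rsBlock n (X₀ * X₀' + n * (Y * Z')) (X₀ * Y' + Y * (X₁' - X') + n * (Y * X'))
        (Z * X₀' + (X₁ - X) * Z' + n * (X * Z'))
        (Z * Y' + (X₁ - X) * X₁' + X * (X₁' - X') + n * (X * X'))
        (Z * Y' + (X₁ - X) * X' + X * (X₁' - X') + n * (X * X')) := by
  have split (i j : Fin n) (U V : E) :
      (if i = j then U else V) = (if i = j then U - V else 0) + V := by
    split_ifs <;> simp
  ext a c
  rw [Matrix.mul_apply, Fin.sum_univ_succ]
  cases a using Fin.cases <;> cases c using Fin.cases <;>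
    simp only [rsBlock, Matrix.of_apply, Fin.succ_ne_zero, if_true, if_false, Fin.succ_inj]
  · simp
  · simp_rw [split _ _ X₁' X', mul_add, Finset.sum_add_distrib]
    simp [add_assoc]
  · simp_rw [split _ _ X₁ X, add_mul, Finset.sum_add_distrib]
    simp [add_assoc]
  · simp_rw [split _ _ X₁' X', split _ _ X₁ X, add_mul, mul_add, Finset.sum_add_distrib]
    simp [ite_mul, mul_ite]
    split_ifs <;> noncomm_ring

theorem sum_rsBlock_zero {E : Type*} [Ring E] {n : ℕ} (X₀ Y Z X₁ X : E) :
    ∑ b, rsBlock n X₀ Y Z X₁ X b 0 = X₀ + n * Z := by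
  simp [Fin.sum_univ_succ, rsBlock]

theorem sum_rsBlock_succ {E : Type*} [Ring E] {n : ℕ} (X₀ Y Z X₁ X : E) (c : Fin n) :
    ∑ b, rsBlock n X₀ Y Z X₁ X b c.succ = Y + (X₁ - X) + n * X := by
  have split (i : Fin n) :
      (if i = c then X₁ else X) = (if i = c then X₁ - X else 0) + X := by
    split_ifs <;> simp
  simp [Fin.sum_univ_succ, rsBlock, split, Finset.sum_add_distrib, add_assoc]

theorem rsBlock_add_centering_mul {E : Type*} [Ring E] [Algebra ℂ E] {n : ℕ} {N β : ℂ}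
    {Q₀ Q₁ Q M M' S₀ S G T P : E}
    (hS₀ : S₀ = N • 1 + β • (Q₀ - M - M' + Q)) (hS : S = N • 1 + β • (Q₁ - Q))
    (hST : S * T = 1) (hG : (S + (n : ℂ) • S₀) * G = 1) (hP : (n : ℂ) • P = T - G)
    (hSP : S * P = S₀ * G) :
    (N * (1 + n)) • rsBlock n (-(n : ℂ) • G) G G (P - T) P +
      β • (centering n E * (rsBlock n Q₀ M M' Q₁ Q * rsBlock n (-(n : ℂ) • G) G G (P - T) P)) =
      -centering n E := by
  have cast (x : E) : (n : E) * x = (n : ℂ) • x := by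
    rw [← map_natCast (algebraMap ℂ E) n, Algebra.smul_def]
  have cast_one : (n : E) = (n : ℂ) • (1 : E) := by rw [← cast, mul_one]
  have row (X : E) : X * G + X * (P - T - P) + n * (X * P) = 0 := by
    rw [cast, ← mul_smul_comm, hP]; noncomm_ring
  have hQT : β • ((Q₁ - Q) * T) = 1 - N • T := by
    rw [← hST, hS]; simp [add_mul]
  have hQP : β • ((Q₁ - Q) * P) = S₀ * G - N • P := by
    rw [← hSP, hS]; simp [add_mul]
  have hQG : β • ((Q₁ - Q) * G) = 1 - (n : ℂ) • (S₀ * G) - N • G := by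
    rw [← hG, hS]; simp [add_mul]
  have hQ₀G : β • (Q₀ * G) - β • (M * G) - β • (M' * G) + β • (Q * G) = S₀ * G - N • G := by
    rw [hS₀]; simp [add_mul, sub_mul, smul_add, smul_sub]
  have rowM := row M
  have rowQ := row Q
  simp only [sub_mul, mul_sub, smul_sub, cast] at hQT hQP hQG rowM rowQ
  rw [rsBlock_mul_rsBlock]
  ext a c
  simp only [Matrix.add_apply, Matrix.smul_apply, Matrix.neg_apply, centering_mul_apply]
  cases c using Fin.cases with
  | zero =>
    rw [sum_rsBlock_zero]
    cases a using Fin.cases <;>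
      simp only [rsBlock, centering, Matrix.of_apply, Fin.succ_ne_zero, if_true, if_false,
        add_mul, one_mul, cast_one, smul_mul_assoc, sub_mul, mul_sub, mul_smul_comm]
    · linear_combination (norm := module) (-(n : ℂ) ^ 2) • hQ₀G - (n : ℂ) • hQG
    · linear_combination (norm := module) (n : ℂ) • hQ₀G + hQG
  | succ c =>
    rw [sum_rsBlock_succ]
    cases a using Fin.cases with
    | zero =>
      simp only [rsBlock, centering, Matrix.of_apply, Fin.succ_ne_zero, (Fin.succ_ne_zero _).symm,
        if_true, if_false, add_mul, one_mul, cast, sub_mul, mul_sub]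
      linear_combination (norm := module)
        (n : ℂ) • hQ₀G + ((n : ℂ) * β) • rowM - ((n : ℂ) * β) • rowQ
          - (n : ℂ) • hQP + hQT + N • hP
    | succ a =>
      simp only [rsBlock, centering, Matrix.of_apply, Fin.succ_ne_zero, if_false, Fin.succ_inj,
        add_mul, one_mul, cast, sub_mul, mul_sub]
      split_ifs
      · rw [cast_one]
        linear_combination (norm := module)
          -hQ₀G + hQP + β • rowQ - β • rowM - (n : ℂ) • hQT + N • hP
      · linear_combination (norm := module) -hQ₀G + hQP + β • rowQ - β • rowM + hQT + N • hP

theorem rsMat_eq_comp {n d : ℕ} (X₀ Y X₁ X : Matrix (Fin d) (Fin d) ℂ) :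
    rsMat n d X₀ Y X₁ X = Matrix.comp _ _ _ _ ℂ (rsBlock n X₀ Y Yᴴ X₁ X) := by
  ext ⟨a, i⟩ ⟨b, j⟩
  simp only [rsMat, rsBlock, Matrix.comp_apply, Matrix.of_apply]
  split_ifs <;> rfl

theorem kronecker_one_eq_comp_centering {n d : ℕ} :
    (centering n ℂ) ⊗ₖ (1 : Matrix (Fin d) (Fin d) ℂ) =
      Matrix.comp _ _ _ _ ℂ (centering n (Matrix (Fin d) (Fin d) ℂ)) := by
  ext ⟨a, i⟩ ⟨b, j⟩
  by_cases h : a = b <;> by_cases h' : i = j <;>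
    simp [centering, Matrix.kroneckerMap_apply, Matrix.comp_apply, h, h', Matrix.natCast_apply]

/-- Replica-symmetric solution of the stationarity condition
`𝒬̃ = −β⁻¹ (I + A 𝒬)⁻¹ A`: the conjugate order-parameter matrix is replica symmetric
with blocks `Q̃₀ = −n(Σ + nΣ₀)⁻¹`, `M̃ = (Σ + nΣ₀)⁻¹`, `Q̃ = (Σ + nΣ₀)⁻¹ Σ₀ Σ⁻¹`,
`Q̃₁ = Q̃ − Σ⁻¹`. -/
theorem replica_symmetric_stationarity (n d : ℕ) (hn : 1 ≤ n) (hd : 1 ≤ d)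
    (β N₀ : ℝ) (hβ : 0 < β) (hN₀ : 0 < N₀)
    (Q₀ Q₁ Q M : Matrix (Fin d) (Fin d) ℂ)
    (hQ₀ : Q₀.IsHermitian) (hQ₁ : Q₁.IsHermitian) (hQ : Q.IsHermitian)
    (S₀ S : Matrix (Fin d) (Fin d) ℂ)
    (hS₀def : S₀ = (N₀ : ℂ) • 1 + (β : ℂ) • (Q₀ - M - Mᴴ + Q))
    (hSdef : S = (N₀ : ℂ) • 1 + (β : ℂ) • (Q₁ - Q))
    (hS : IsUnit S.det) (hSn : IsUnit (S + (n : ℂ) • S₀).det) :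
    let B : Matrix (Fin (n + 1)) (Fin (n + 1)) ℂ :=
      Matrix.of fun a b =>
        if a = 0 then (if b = 0 then (n : ℂ) else -1)
        else if b = 0 then -1
        else (if a = b then 1 + (n : ℂ) else 0) - 1
    let A : Matrix (Fin (n + 1) × Fin d) (Fin (n + 1) × Fin d) ℂ :=
      ((β / (N₀ * (1 + (n : ℝ))) : ℝ) : ℂ) • (B ⊗ₖ (1 : Matrix (Fin d) (Fin d) ℂ))
    let Qm := rsMat n d Q₀ M Q₁ Q
    IsUnit (1 + A * Qm).det ∧
    (-(β : ℂ)⁻¹) • ((1 + A * Qm)⁻¹ * A)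
      = rsMat n d
          ((-(n : ℂ)) • (S + (n : ℂ) • S₀)⁻¹)
          ((S + (n : ℂ) • S₀)⁻¹)
          ((S + (n : ℂ) • S₀)⁻¹ * S₀ * S⁻¹ - S⁻¹)
          ((S + (n : ℂ) • S₀)⁻¹ * S₀ * S⁻¹) := by
  intro B A Qm
  set G := (S + (n : ℂ) • S₀)⁻¹ with hGdef
  set T := S⁻¹
  set P := G * S₀ * T with hPdef
  have hn' : (n : ℂ) ≠ 0 := by exact_mod_cast (by lia : n ≠ 0)
  have hβ' : (β : ℂ) ≠ 0 := by exact_mod_cast hβ.ne'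
  have hN' : (N₀ : ℂ) ≠ 0 := by exact_mod_cast hN₀.ne'
  have hn1 : (1 + n : ℂ) ≠ 0 := by exact_mod_cast (by lia : 1 + n ≠ 0)
  have hST : S * T = 1 := Matrix.mul_nonsing_inv S hS
  have hG : (S + (n : ℂ) • S₀) * G = 1 := Matrix.mul_nonsing_inv _ hSn
  have hG' : G * (S + (n : ℂ) • S₀) = 1 := Matrix.nonsing_inv_mul _ hSn
  have hP : (n : ℂ) • P = T - G := by
    have : (n : ℂ) • (G * S₀) = 1 - G * S := by
      rw [← hG', mul_add, mul_smul_comm]; abel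
    rw [hPdef, ← smul_mul_assoc, this, sub_mul, one_mul, mul_assoc, hST, mul_one]
  have hSP : S * P = S₀ * G := by
    apply smul_right_injective _ hn'
    change (n : ℂ) • (S * P) = (n : ℂ) • (S₀ * G)
    rw [← mul_smul_comm, hP, mul_sub, hST, ← hG, add_mul, smul_mul_assoc]
    abel
  have hGH : Gᴴ = G := by
    have hSH : S.IsHermitian := by
      simp [hSdef, Matrix.IsHermitian, Matrix.conjTranspose_smul, hQ₁.eq, hQ.eq]
    have hS₀H : S₀.IsHermitian := by
      simp [hS₀def, Matrix.IsHermitian, Matrix.conjTranspose_smul, hQ₀.eq, hQ.eq, sub_right_comm]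
    rw [hGdef, Matrix.conjTranspose_nonsing_inv]
    simp [Matrix.conjTranspose_smul, hSH.eq, hS₀H.eq]
  set Qt := rsMat n d ((-(n : ℂ)) • G) G (P - T) P with hQt
  let φ := Matrix.compAlgEquiv (Fin (n + 1)) (Fin d) ℂ ℂ
  have hQm : Qm = φ (rsBlock n Q₀ M Mᴴ Q₁ Q) := rsMat_eq_comp ..
  have hQtφ : Qt = φ (rsBlock n ((-(n : ℂ)) • G) G G (P - T) P) := by
    rw [hQt, rsMat_eq_comp, hGH]; rfl
  have hA : A = ((β / (N₀ * (1 + n)) : ℂ)) • φ (centering n _) := by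
    have hcast : ((β / (N₀ * (1 + (n : ℝ))) : ℝ) : ℂ) = β / (N₀ * (1 + n)) := by push_cast; rfl
    have hB : B = centering n ℂ := by
      ext a b
      cases a using Fin.cases <;> cases b using Fin.cases <;>
        simp [B, centering, Fin.succ_ne_zero, (Fin.succ_ne_zero _).symm, add_comm]
    simp only [A, hcast, hB, kronecker_one_eq_comp_centering]
    rfl
  clear_value A Qm
  have key := congrArg φ (rsBlock_add_centering_mul hS₀def hSdef hST hG hP hSP)
  rw [map_add, map_smul, map_smul, map_mul, map_mul, map_neg, ← hQm, ← hQtφ] at key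
  have hQtA : (1 + A * Qm) * Qt = (-(β : ℂ)⁻¹) • A := by
    apply smul_right_injective _ (mul_ne_zero hN' hn1)
    change (N₀ * (1 + n) : ℂ) • _ = (N₀ * (1 + n) : ℂ) • _
    rw [add_mul, one_mul, smul_add, mul_assoc, hA, smul_mul_assoc, smul_smul, smul_smul, smul_smul,
      mul_div_cancel₀ _ (mul_ne_zero hN' hn1), key, ← neg_one_smul ℂ]
    congr 1
    field_simp
  have hinv : (1 + A * Qm) * (1 + (β : ℂ) • (Qt * Qm)) = 1 := by
    rw [mul_add, mul_one, mul_smul_comm, ← mul_assoc, hQtA, smul_mul_assoc, smul_smul]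
    rw [mul_neg, mul_inv_cancel₀ hβ', neg_one_smul, add_neg_cancel_right]
  have hunit : IsUnit (1 + A * Qm).det := Matrix.isUnit_det_of_right_inverse hinv
  refine ⟨hunit, ?_⟩
  rw [← mul_smul_comm, ← hQtA, Matrix.nonsing_inv_mul_cancel_left _ _ hunit]
end

section
/- Fix integers n ≥ 1 and d ≥ 1 and reals β > 0 and N₀ > 0. Let Q₀, Q₁, Q ∈ ℂ^{d×d} be Hermitian and M ∈ ℂ^{d×d}, let 𝒬 = [[Q₀, 1ₙᵀ ⊗ M], [1ₙ ⊗ M^H, Iₙ ⊗ (Q₁ − Q) + Jₙ ⊗ Q]] be the replica-symmetric matrix of size (n+1)d, and set Σ₀ = N₀ I_d + β(Q₀ − M − M^H + Q) and Σ = N₀ I_d + β(Q₁ − Q), assumed invertible along with Σ + n Σ₀. Let 𝒬̃ be the replica-symmetric matrix with blocks Q̃₀ = −n (Σ + n Σ₀)^{-1}, M̃ = (Σ + n Σ₀)^{-1}, Q̃ = (Σ + n Σ₀)^{-1} Σ₀ Σ^{-1}, Q̃₁ = Q̃ − Σ^{-1}. Then Tr( 𝒬 𝒬̃ ) = −(n/β)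 · Tr[ I_d − N₀ (Σ + n Σ₀)^{-1} − N₀ Σ^{-1} + N₀ (Σ + n Σ₀)^{-1} Σ₀ Σ^{-1} ]. -/
open Matrix Finset

/-- The trace of a product of two replica-symmetric matrices in terms of their blocks. -/
theorem trace_rsMat_mul_rsMat (n d : ℕ) (X₀ Y X₁ X X₀' Y' X₁' X' : Matrix (Fin d) (Fin d) ℂ) :
    (rsMat n d X₀ Y X₁ X * rsMat n d X₀' Y' X₁' X').trace
      = (X₀ * X₀').trace + n * (Y * Y'ᴴ).trace + n * (Yᴴ * Y').trace
        + n * (X₁ * X₁').trace + n * ((n : ℂ) - 1) * (X * X').trace := by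
  have hblock : (rsMat n d X₀ Y X₁ X * rsMat n d X₀' Y' X₁' X').trace
      = ∑ i : Fin (n + 1), ∑ j : Fin (n + 1),
          if i = 0 then (if j = 0 then (X₀ * X₀').trace else (Y * Y'ᴴ).trace)
          else if j = 0 then (Yᴴ * Y').trace
          else (X * X').trace + if i = j then (X₁ * X₁').trace - (X * X').trace else 0 := by
    simp only [Matrix.trace, Matrix.diag, Matrix.mul_apply, Fintype.sum_prod_type]
    refine Finset.sum_congr rfl fun i _ => ?_
    rw [Finset.sum_comm]
    refine Finset.sum_congr rfl fun j _ => ?_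
    by_cases hi : i = 0 <;> by_cases hj : j = 0
    · simp [rsMat, hi, hj]
    · simp [rsMat, hi, hj]
    · simp [rsMat, hi, hj]
    · by_cases hij : i = j
      · subst hij
        simp [rsMat, hi]
      · simp [rsMat, hi, hj, hij, Ne.symm hij]
  rw [hblock]
  simp only [Fin.sum_univ_succ, Fin.succ_ne_zero, if_true, if_false, Fin.succ_inj,
    Finset.sum_add_distrib, Finset.sum_ite_eq, Finset.mem_univ, Finset.sum_const,
    Finset.card_univ, Fintype.card_fin, nsmul_eq_mul]
  ring

/-- Trace of the product of the replica-symmetric order parameter `𝒬` and its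
conjugate `𝒬̃` at the replica-symmetric saddle point:
`Tr(𝒬 𝒬̃) = −(n/β) Tr[I − N₀(Σ + nΣ₀)⁻¹ − N₀Σ⁻¹ + N₀(Σ + nΣ₀)⁻¹ Σ₀ Σ⁻¹]`. -/
theorem replica_symmetric_trace_identity (n d : ℕ) (hn : 1 ≤ n) (hd : 1 ≤ d)
    (β N₀ : ℝ) (hβ : 0 < β) (hN₀ : 0 < N₀)
    (Q₀ Q₁ Q M : Matrix (Fin d) (Fin d) ℂ)
    (hQ₀ : Q₀.IsHermitian) (hQ₁ : Q₁.IsHermitian) (hQ : Q.IsHermitian)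
    (S₀ S : Matrix (Fin d) (Fin d) ℂ)
    (hS₀def : S₀ = (N₀ : ℂ) • 1 + (β : ℂ) • (Q₀ - M - Mᴴ + Q))
    (hSdef : S = (N₀ : ℂ) • 1 + (β : ℂ) • (Q₁ - Q))
    (hS : IsUnit S.det) (hSn : IsUnit (S + (n : ℂ) • S₀).det) :
    let Qm := rsMat n d Q₀ M Q₁ Q
    let Qt := rsMat n d
      ((-(n : ℂ)) • (S + (n : ℂ) • S₀)⁻¹)
      ((S + (n : ℂ) • S₀)⁻¹)
      ((S + (n : ℂ) • S₀)⁻¹ * S₀ * S⁻¹ - S⁻¹)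
      ((S + (n : ℂ) • S₀)⁻¹ * S₀ * S⁻¹)
    (Qm * Qt).trace
      = -((n : ℂ) / (β : ℂ)) *
          ((1 : Matrix (Fin d) (Fin d) ℂ)
            - (N₀ : ℂ) • (S + (n : ℂ) • S₀)⁻¹
            - (N₀ : ℂ) • S⁻¹
            + (N₀ : ℂ) • ((S + (n : ℂ) • S₀)⁻¹ * S₀ * S⁻¹)).trace := by
  intro Qm Qt
  have hβ' : (β : ℂ) ≠ 0 := by exact_mod_cast hβ.ne'
  have hSherm : S.IsHermitian := by
    simp [hSdef, Matrix.IsHermitian, hQ₁.eq, hQ.eq]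
  have hS₀herm : S₀.IsHermitian := by
    simp only [hS₀def, Matrix.IsHermitian, conjTranspose_add, conjTranspose_smul,
      conjTranspose_sub, conjTranspose_one, conjTranspose_conjTranspose, hQ₀.eq, hQ.eq,
      Complex.star_def, Complex.conj_ofReal]
    rw [sub_right_comm]
  have hAherm : ((S + (n : ℂ) • S₀)⁻¹)ᴴ = (S + (n : ℂ) • S₀)⁻¹ := by
    rw [conjTranspose_nonsing_inv]
    simp [hSherm.eq, hS₀herm.eq]
  have hnC : (n : ℂ) • ((S + (n : ℂ) • S₀)⁻¹ * S₀ * S⁻¹) = S⁻¹ - (S + (n : ℂ) • S₀)⁻¹ := by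
    have h := nonsing_inv_mul _ hSn
    rw [mul_add, Matrix.mul_smul] at h
    rw [← Matrix.smul_mul, eq_sub_of_add_eq' h, Matrix.sub_mul, one_mul,
      Matrix.mul_assoc, mul_nonsing_inv _ hS, mul_one]
  have hSB : (S * S⁻¹).trace = (1 : Matrix (Fin d) (Fin d) ℂ).trace := by
    rw [mul_nonsing_inv _ hS]
  have hSC : (S * ((S + (n : ℂ) • S₀)⁻¹ * S₀ * S⁻¹)).trace
      = (S₀ * (S + (n : ℂ) • S₀)⁻¹).trace := by
    rw [trace_mul_comm, Matrix.mul_assoc, nonsing_inv_mul _ hS, mul_one, trace_mul_comm]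
  simp only [Qm, Qt]
  rw [trace_rsMat_mul_rsMat, hAherm]
  generalize (S + (n : ℂ) • S₀)⁻¹ * S₀ * S⁻¹ = C at *
  generalize (S + (n : ℂ) • S₀)⁻¹ = A at *
  generalize S⁻¹ = B at *
  have hQC := congrArg (fun Z => (Q * Z).trace) hnC
  have hS₀A := congrArg (fun Z => (Z * A).trace) hS₀def
  have hSB' := congrArg (fun Z => (Z * B).trace) hSdef
  have hSC' := congrArg (fun Z => (Z * C).trace) hSdef
  simp only [Matrix.mul_sub, Matrix.mul_smul, Matrix.sub_mul, Matrix.add_mul, Matrix.smul_mul,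
    one_mul, trace_add, trace_sub, trace_smul, smul_eq_mul] at hQC hS₀A hSB' hSC' ⊢
  rw [hSB] at hSB'
  rw [hSC] at hSC'
  field_simp
  linear_combination (n : ℂ) * β * hQC + n * hS₀A + n * hSB' - n * hSC'
end
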